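/- Let 𝒜 : ℝ^{m×n} → ℝ^d be a linear map, b ∈ ℝ^d, λ > 0, a > 0, and 0 < μ ≤ 1/‖𝒜‖₂². Define C_λ(X) = ‖𝒜(X) − b‖₂² + λP_a(X) and C_{λ,μ}(X, Z) = μ[C_λ(X) − ‖𝒜(X) − 𝒜(Z)‖₂²] + ‖X − Z‖_F². If X* ∈ ℝ^{m×n} is a global minimizer of C_λ, then X* is a global minimizer of the map X ↦ C_{λ,μ}(X, X*); that is, C_{λ,μ}(X, X*) ≥ C_{λ,μ}(X*, X*) for all X ∈ ℝ^{m×n}. -/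

import Mathlib

open Matrix
attribute [local instance] Matrix.frobeniusNormedAddCommGroup Matrix.frobeniusNormedSpace

/-- The singular values of a real `m × n` matrix `X` (in some order):
the square roots of the eigenvalues of the positive semidefinite matrix `X * Xᴴ = X * Xᵀ`. -/
noncomputable def singVals {m n : ℕ} (X : Matrix (Fin m) (Fin n) ℝ) : Fin m → ℝ :=
  fun i => Real.sqrt ((Matrix.isHermitian_mul_conjTranspose_self X).eigenvalues i)

/-- The non-convex surrogate `P_a(X) = ∑_{i=1}^m a σ_i(X) / (a σ_i(X) + 1)`. -/
noncomputable def Pa {m n : ℕ} (a : ℝ) (X : Matrix (Fin m) (Fin n) ℝ) : ℝ :=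
  ∑ i : Fin m, a * singVals X i / (a * singVals X i + 1)

/-- The objective `C_λ(X) = ‖𝒜(X) − b‖₂² + λ P_a(X)`. -/
noncomputable def Cobj {m n d : ℕ}
    (A : Matrix (Fin m) (Fin n) ℝ →L[ℝ] EuclideanSpace ℝ (Fin d))
    (b : EuclideanSpace ℝ (Fin d)) (lam a : ℝ) (X : Matrix (Fin m) (Fin n) ℝ) : ℝ :=
  ‖A X - b‖ ^ 2 + lam * Pa a X

/-- The surrogate `C_{λ,μ}(X, Z) = μ [C_λ(X) − ‖𝒜(X) − 𝒜(Z)‖₂²] + ‖X − Z‖_F²`. -/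
noncomputable def Csur {m n d : ℕ}
    (A : Matrix (Fin m) (Fin n) ℝ →L[ℝ] EuclideanSpace ℝ (Fin d))
    (b : EuclideanSpace ℝ (Fin d)) (lam a μ : ℝ) (X Z : Matrix (Fin m) (Fin n) ℝ) : ℝ :=
  μ * (Cobj A b lam a X - ‖A X - A Z‖ ^ 2) + ‖X - Z‖ ^ 2

/-- If `0 < μ ≤ 1/‖𝒜‖₂²` and `X*` is a global minimizer of `C_λ`, then `X*` is a global
minimizer of `X ↦ C_{λ,μ}(X, X*)`, i.e. `C_{λ,μ}(X, X*) ≥ C_{λ,μ}(X*, X*)` for all `X`. -/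
theorem minimizer_surrogate {m n d : ℕ}
    (A : Matrix (Fin m) (Fin n) ℝ →L[ℝ] EuclideanSpace ℝ (Fin d))
    (b : EuclideanSpace ℝ (Fin d)) (lam a μ : ℝ)
    (hlam : 0 < lam) (ha : 0 < a) (hμ0 : 0 < μ) (hμ : μ ≤ 1 / (ContinuousLinearMap.hasOpNorm.norm A) ^ 2)
    (Xstar : Matrix (Fin m) (Fin n) ℝ)
    (hXstar : ∀ X : Matrix (Fin m) (Fin n) ℝ, Cobj A b lam a Xstar ≤ Cobj A b lam a X) :
    ∀ X : Matrix (Fin m) (Fin n) ℝ,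
      Csur A b lam a μ X Xstar ≥ Csur A b lam a μ Xstar Xstar := by
  intro X
  have h1 := hXstar X
  have h2 : ‖A X - A Xstar‖ ≤ (ContinuousLinearMap.hasOpNorm.norm A) * ‖X - Xstar‖ := by
    rw [← map_sub]
    exact ContinuousLinearMap.le_opNorm A (X - Xstar)
  generalize (ContinuousLinearMap.hasOpNorm.norm A) = K at hμ h2
  have hK : 0 < K ^ 2 := by
    by_contra h
    have h0 : K ^ 2 = 0 := le_antisymm (not_lt.mp h) (sq_nonneg K)
    rw [h0] at hμ
    simp at hμ
    linarith
  have h3 : μ * K ^ 2 ≤ 1 := (le_div_iff₀ hK).mp hμ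
  have h4 : ‖A X - A Xstar‖ ^ 2 ≤ K ^ 2 * ‖X - Xstar‖ ^ 2 := by
    rw [← mul_pow]
    exact pow_le_pow_left₀ (norm_nonneg _) h2 2
  have h5 : μ * ‖A X - A Xstar‖ ^ 2 ≤ ‖X - Xstar‖ ^ 2 := by
    calc μ * ‖A X - A Xstar‖ ^ 2 ≤ μ * (K ^ 2 * ‖X - Xstar‖ ^ 2) :=
          mul_le_mul_of_nonneg_left h4 hμ0.le
      _ = (μ * K ^ 2) * ‖X - Xstar‖ ^ 2 := by ring
      _ ≤ 1 * ‖X - Xstar‖ ^ 2 := mul_le_mul_of_nonneg_right h3 (sq_nonneg _)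
      _ = _ := one_mul _
  have h6 := mul_le_mul_of_nonneg_left h1 hμ0.le
  have e : Csur A b lam a μ Xstar Xstar = μ * Cobj A b lam a Xstar := by
    unfold Csur
    rw [sub_self, sub_self, norm_zero, norm_zero]
    ring
  rw [e]
  unfold Csur
  rw [mul_sub]
  linarith
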